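/- arXiv:1410.7878 — 4 statements merged into one kernel-verified Lean document; each statement's English description precedes it below -/
import Mathlib

section
/- Let x : ℝ → ℝ² be a C² curve. Then lim_{ε→0} (1/ε³)·det[x(ε) − x(0), x(2ε) − x(0)] = det[x'(0), x''(0)] = x₁'(0)x₂''(0) − x₁''(0)x₂'(0), where det[u, v] denotes the determinant of the 2×2 matrix with columns u and v. (This is the paper's computation that the twisted derivative of the oriented-area 3-joint invariant of the Euclidean plane yields the second-order differential invariant x'y'' − x''y'.) -/
open Filter Topology

/-- The second-order Taylor quotient of a `C²` function tends to half the second derivative. -/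
theorem tendsto_taylor_quotient_two {E : Type*} [NormedAddCommGroup E] [NormedSpace ℝ E]
    {f : ℝ → E} (hf : ContDiff ℝ 2 f) (x₀ : ℝ) :
    Tendsto (fun t : ℝ => (t ^ 2)⁻¹ • (f (x₀ + t) - f x₀ - t • deriv f x₀)) (𝓝[≠] 0)
      (𝓝 ((2⁻¹ : ℝ) • deriv (deriv f) x₀)) := by
  have h := (taylor_isLittleO_univ (x₀ := x₀) (n := 2) hf).tendsto_inv_smul_nhds_zero
  have hshift : Tendsto (fun t : ℝ => x₀ + t) (𝓝[≠] 0) (𝓝 x₀) := by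
    have : Tendsto (fun t : ℝ => x₀ + t) (𝓝 0) (𝓝 (x₀ + 0)) :=
      (continuous_const.add continuous_id).tendsto 0
    simpa using this.mono_left nhdsWithin_le_nhds
  have h' := (h.comp hshift).add_const ((2⁻¹ : ℝ) • deriv (deriv f) x₀)
  rw [zero_add] at h'
  refine h'.congr' ?_
  filter_upwards [self_mem_nhdsWithin] with t ht
  have ht : t ≠ 0 := ht
  simp only [Function.comp, taylorWithinEval_succ, taylor_within_zero_eval,
    iteratedDerivWithin_univ, iteratedDeriv_succ, iteratedDeriv_zero, add_sub_cancel_left]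
  norm_num
  match_scalars <;> field_simp
  ring

/-- **Twisted derivative of the oriented area.** For a `C²` curve `x : ℝ → ℝ²`,
`lim_{ε→0} (1/ε³)·det[x(ε) − x(0), x(2ε) − x(0)] = det[x'(0), x''(0)]
  = x₁'(0)·x₂''(0) − x₁''(0)·x₂'(0)`,
where `det[u,v] = u₁v₂ − u₂v₁`. -/
theorem oriented_area_twisted_derivative
    (x : ℝ → ℝ × ℝ) (hx : ContDiff ℝ 2 x) :
    Filter.Tendsto
      (fun ε : ℝ =>
        ((x ε - x 0).1 * (x (2 * ε) - x 0).2 - (x ε - x 0).2 * (x (2 * ε) - x 0).1) / ε ^ 3)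
      (nhdsWithin 0 {0}ᶜ)
      (nhds ((deriv x 0).1 * (deriv (deriv x) 0).2 - (deriv (deriv x) 0).1 * (deriv x 0).2)) := by
  have hr := tendsto_taylor_quotient_two hx 0
  have hdouble : Tendsto (fun t : ℝ => 2 * t) (𝓝[≠] 0) (𝓝[≠] 0) := by
    refine tendsto_nhdsWithin_iff.2 ⟨?_, ?_⟩
    · have : Tendsto (fun t : ℝ => 2 * t) (𝓝 0) (𝓝 (2 * 0)) :=
        (continuous_const.mul continuous_id).tendsto 0
      simpa using this.mono_left nhdsWithin_le_nhds
    · filter_upwards [self_mem_nhdsWithin] with t ht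
      simpa using ht
  have hs := hr.comp hdouble
  have hid : Tendsto (fun t : ℝ => t) (𝓝[≠] 0) (𝓝 0) := nhdsWithin_le_nhds
  have hr1 := (continuous_fst.tendsto _).comp hr
  have hr2 := (continuous_snd.tendsto _).comp hr
  have hs1 := (continuous_fst.tendsto _).comp hs
  have hs2 := (continuous_snd.tendsto _).comp hs
  have key := (((hs2.const_mul (deriv x 0).1).sub (hs1.const_mul (deriv x 0).2)).const_mul 4).add
    ((((hr1.mul_const (deriv x 0).2).sub (hr2.mul_const (deriv x 0).1)).const_mul 2).add
      ((hid.const_mul 4).mul ((hr1.mul hs2).sub (hr2.mul hs1))))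
  convert key.congr' ?_ using 2
  · simp only [Prod.smul_fst, Prod.smul_snd, smul_eq_mul]
    ring
  · filter_upwards [self_mem_nhdsWithin] with t ht
    have ht : t ≠ 0 := ht
    simp only [Function.comp, Prod.smul_fst, Prod.smul_snd, Prod.fst_sub, Prod.snd_sub,
      smul_eq_mul, zero_add]
    field_simp
    ring
end

section
/- Let n ≥ 1 and let x : ℝ → ℝⁿ be a C^∞ (or Cⁿ) curve. Consider the n×n matrix whose i-th column is x(iε) − x(0), for i = 1,…,n. Then lim_{ε→0} ε^{−n(n+1)/2} · det[x(ε) − x(0), x(2ε) − x(0), …, x(nε) − x(0)] = Λₙ · W, where Λₙ = (1/(1!·2!⋯n!)) · det[(i^j)_{i,j=1,…,n}] and W = det[(x_m^{(j)}(0))_{m,j=1,…,n}] is the Wronskian-type determinant whose (m,j) entry is the j-th derivative of the m-th component of x at 0. (This is the paper's computation of the twisted derivative of the oriented n-dimensional volume joint invariant of Euclidean geometry; the leading power of ε is n(n+1)/2 = 1+2+⋯+n.) -/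
open Matrix

/-- The matrix of powers `(i + 1) ^ (j + 1)` is invertible. -/
lemma det_succ_pow_succ_ne_zero (n : ℕ) :
    (Matrix.of fun i j : Fin n => (((i : ℕ) + 1 : ℕ) : ℝ) ^ ((j : ℕ) + 1)).det ≠ 0 := by
  have h : (Matrix.of fun i j : Fin n => (((i : ℕ) + 1 : ℕ) : ℝ) ^ ((j : ℕ) + 1)) =
      Matrix.of fun i j : Fin n => (((i : ℕ) + 1 : ℕ) : ℝ) *
        Matrix.vandermonde (fun i : Fin n => (((i : ℕ) + 1 : ℕ) : ℝ)) i j := by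
    ext i j
    simp only [Matrix.of_apply, Matrix.vandermonde_apply, pow_succ']
  rw [h, Matrix.det_mul_column]
  refine mul_ne_zero (Finset.prod_ne_zero_iff.2 fun i _ => Nat.cast_ne_zero.2 i.val.succ_ne_zero)
    (Matrix.det_vandermonde_ne_zero_iff.2 fun i j hij => ?_)
  simpa [Fin.ext_iff] using hij

lemma prod_pow_succ {R : Type*} [CommMonoid R] (n : ℕ) (a : R) :
    ∏ j : Fin n, a ^ ((j : ℕ) + 1) = a ^ (n * (n + 1) / 2) := by
  rw [Finset.prod_pow_eq_pow_sum, Fin.sum_univ_eq_sum_range (fun j => j + 1) n]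
  congr 1
  have h := Finset.sum_range_id_mul_two (n + 1)
  rw [Finset.sum_range_succ'] at h
  rw [Nat.add_sub_cancel, mul_comm (n + 1)] at h
  omega

/-- Peano form of Taylor's theorem at `0`, with the constant term moved to the left. -/
lemma sub_sum_taylor_isLittleO {f : ℝ → ℝ} {n : ℕ} (hf : ContDiff ℝ n f) :
    (fun s => f s - f 0 - ∑ j : Fin n,
      iteratedDeriv ((j : ℕ) + 1) f 0 / (Nat.factorial ((j : ℕ) + 1) : ℝ) * s ^ ((j : ℕ) + 1))
      =o[nhds 0] fun s => s ^ n := by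
  have h := taylor_isLittleO_univ (x₀ := 0) hf
  simp only [sub_zero] at h
  refine h.congr_left fun s => ?_
  rw [taylor_within_apply, Finset.sum_range_succ', sub_sub,
    Fin.sum_univ_eq_sum_range (fun j => iteratedDeriv (j + 1) f 0 /
      (Nat.factorial (j + 1) : ℝ) * s ^ (j + 1)) n, add_comm (f 0)]
  simp only [iteratedDerivWithin_univ, smul_eq_mul, sub_zero, iteratedDeriv_zero, pow_zero,
    Nat.factorial_zero, Nat.cast_one, inv_one, one_mul]
  congr 2
  exact Finset.sum_congr rfl fun j _ => by ring

/-- A function that is `o(s ^ n)` at `0` stays negligible after rescaling its argument and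
dividing by a power `k ≤ n`. -/
lemma tendsto_comp_mul_div_pow {r : ℝ → ℝ} {n k : ℕ} (hr : r =o[nhds 0] fun s => s ^ n)
    (hk : k ≤ n) (c : ℝ) :
    Filter.Tendsto (fun ε => r (c * ε) / ε ^ k) (nhdsWithin 0 {0}ᶜ) (nhds 0) := by
  have hc : Filter.Tendsto (fun ε : ℝ => c * ε) (nhds 0) (nhds 0) := by
    simpa using (continuous_const_mul c).tendsto 0
  have h1 : (fun ε => r (c * ε)) =o[nhds 0] fun ε => ε ^ n := by
    refine (hr.comp_tendsto hc).trans_isBigO ?_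
    simp only [Function.comp_def, mul_pow]
    exact Asymptotics.isBigO_const_mul_self _ _ _
  have h2 : (fun ε : ℝ => ε ^ n) =O[nhds 0] fun ε => ε ^ k := by
    obtain ⟨d, rfl⟩ := Nat.exists_eq_add_of_le hk
    have hd : (fun ε : ℝ => ε ^ d) =O[nhds 0] fun _ => (1 : ℝ) :=
      ((continuous_pow d).tendsto 0).isBigO_one ℝ
    simpa [pow_add] using (Asymptotics.isBigO_refl (fun ε : ℝ => ε ^ k) (nhds 0)).mul hd
  exact ((h1.trans_isBigO h2).mono nhdsWithin_le_nhds).tendsto_div_nhds_zero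

/-- **Twisted derivative of the oriented volume.** Let `n ≥ 1` and `x : ℝ → ℝⁿ` a smooth curve.
Consider the `n×n` matrix whose `i`-th column is `x(iε) − x(0)`, `i = 1,…,n`. Then
`lim_{ε→0} ε^{−n(n+1)/2} · det[x(ε) − x(0), …, x(nε) − x(0)] = Λₙ · W`, where
`Λₙ = (1/(1!·2!⋯n!)) · det[(i^j)_{i,j=1,…,n}]` and `W` is the Wronskian-type determinant
whose `(m,j)` entry is the `j`-th derivative at `0` of the `m`-th component of `x`. -/
theorem oriented_volume_twisted_derivative
    (n : ℕ) (hn : 1 ≤ n) (x : ℝ → (Fin n → ℝ)) (hx : ContDiff ℝ (⊤ : ℕ∞) x) :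
    Filter.Tendsto
      (fun ε : ℝ =>
        (Matrix.of fun m i : Fin n => x (((i : ℕ) + 1) * ε) m - x 0 m).det
          / ε ^ (n * (n + 1) / 2))
      (nhdsWithin 0 {0}ᶜ)
      (nhds
        (((1 : ℝ) / ∏ j : Fin n, (Nat.factorial ((j : ℕ) + 1) : ℝ)) *
            (Matrix.of fun i j : Fin n => (((i : ℕ) + 1 : ℕ) : ℝ) ^ ((j : ℕ) + 1)).det *
          (Matrix.of fun m j : Fin n =>
            iteratedDeriv ((j : ℕ) + 1) (fun t => x t m) 0).det)) := by
  set V : Matrix (Fin n) (Fin n) ℝ :=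
    Matrix.of fun i j : Fin n => (((i : ℕ) + 1 : ℕ) : ℝ) ^ ((j : ℕ) + 1) with hV
  have hVdet : IsUnit Vᵀ.det := by
    rw [Matrix.det_transpose]
    exact (det_succ_pow_succ_ne_zero n).isUnit
  set A : Matrix (Fin n) (Fin n) ℝ := Matrix.of fun m j : Fin n =>
    iteratedDeriv ((j : ℕ) + 1) (fun t => x t m) 0 / (Nat.factorial ((j : ℕ) + 1) : ℝ) with hA
  let r : Fin n → ℝ → ℝ := fun m s => x s m - x 0 m - ∑ j : Fin n, A m j * s ^ ((j : ℕ) + 1)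
  let R : ℝ → Matrix (Fin n) (Fin n) ℝ := fun ε => Matrix.of fun m i => r m (((i : ℕ) + 1) * ε)
  let D : ℝ → Matrix (Fin n) (Fin n) ℝ := fun ε => Matrix.diagonal fun j => ε ^ ((j : ℕ) + 1)
  let D' : ℝ → Matrix (Fin n) (Fin n) ℝ :=
    fun ε => Matrix.diagonal fun j => (ε ^ ((j : ℕ) + 1))⁻¹
  have hr (m : Fin n) : r m =o[nhds 0] fun s => s ^ n :=
    sub_sum_taylor_isLittleO
      ((contDiff_pi.1 hx m).of_le (by exact_mod_cast (le_top : (n : ℕ∞) ≤ ⊤)))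
  have hB : Filter.Tendsto (fun ε => A + R ε * Vᵀ⁻¹ * D' ε) (nhdsWithin 0 {0}ᶜ) (nhds A) := by
    refine tendsto_pi_nhds.2 fun m => tendsto_pi_nhds.2 fun j => ?_
    have h : Filter.Tendsto (fun ε => A m j +
        ∑ i : Fin n, r m (((i : ℕ) + 1) * ε) / ε ^ ((j : ℕ) + 1) * Vᵀ⁻¹ i j)
        (nhdsWithin 0 {0}ᶜ) (nhds (A m j + ∑ i : Fin n, 0 * Vᵀ⁻¹ i j)) :=
      tendsto_const_nhds.add <| tendsto_finsetSum _ fun i _ =>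
        (tendsto_comp_mul_div_pow (hr m) j.isLt _).mul_const _
    simp only [zero_mul, Finset.sum_const_zero, add_zero] at h
    refine h.congr fun ε => ?_
    rw [Matrix.add_apply, Matrix.mul_diagonal, Matrix.mul_apply, Finset.sum_mul]
    exact congrArg _ (Finset.sum_congr rfl fun i _ => by simp only [R, Matrix.of_apply]; ring)
  have hM (ε : ℝ) (hε : ε ≠ 0) :
      (Matrix.of fun m i : Fin n => x (((i : ℕ) + 1) * ε) m - x 0 m) =
        (A + R ε * Vᵀ⁻¹ * D' ε) * (D ε * Vᵀ) := by
    have hD : D' ε * D ε = 1 := by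
      simp [D, D', hε]
    have hR : R ε * Vᵀ⁻¹ * D' ε * (D ε * Vᵀ) = R ε := by
      rw [Matrix.mul_assoc, ← Matrix.mul_assoc (D' ε), hD, Matrix.one_mul, Matrix.mul_assoc,
        Matrix.nonsing_inv_mul _ hVdet, Matrix.mul_one]
    rw [Matrix.add_mul, hR]
    ext m i
    have hsum : (A * (D ε * Vᵀ)) m i =
        ∑ j : Fin n, A m j * (((i : ℕ) + 1) * ε) ^ ((j : ℕ) + 1) := by
      rw [Matrix.mul_apply]
      refine Finset.sum_congr rfl fun j _ => ?_
      simp only [D, Matrix.diagonal_mul, Matrix.transpose_apply, hV, Matrix.of_apply, mul_pow]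
      push_cast
      ring
    rw [Matrix.add_apply, hsum]
    simp only [R, r, Matrix.of_apply]
    ring
  have hAdet : A.det = (1 / ∏ j : Fin n, (Nat.factorial ((j : ℕ) + 1) : ℝ)) *
      (Matrix.of fun m j : Fin n => iteratedDeriv ((j : ℕ) + 1) (fun t => x t m) 0).det := by
    rw [one_div, ← Finset.prod_inv_distrib, ← Matrix.det_mul_row]
    congr 1
    ext m j
    simp only [hA, Matrix.of_apply, div_eq_inv_mul]
  rw [mul_right_comm, ← hAdet]
  refine (((continuous_id.matrix_det.tendsto A).comp hB).mul_const V.det).congr' ?_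
  filter_upwards [self_mem_nhdsWithin] with ε hε
  have hpow : ε ^ (n * (n + 1) / 2) ≠ 0 := pow_ne_zero _ hε
  rw [hM ε hε, Matrix.det_mul, Matrix.det_mul, Matrix.det_diagonal, prod_pow_succ,
    Matrix.det_transpose, eq_div_iff hpow]
  simp only [Function.comp_apply, id_eq]
  ring
end

section
/- Let x : ℝ → ℝ be a C² function with x'(0) ≠ 0. Then lim_{ε→0} (1/ε) · ( (x(2ε) − x(0)) / (x(ε) − x(0)) − 2 ) = x''(0)/x'(0). (This is the paper's computation that the twisted derivative of the affine-ratio 3-joint invariant of the affine group of the line produces the differential invariant x''/x' of rank 1 and order 2; note that for all sufficiently small ε ≠ 0 the denominator x(ε) − x(0) is nonzero because x'(0) ≠ 0.) -/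
open Filter Topology in
/-- The quadratic Taylor expansion at `0`, with the remainder written as a limit. -/
theorem tendsto_quadratic_taylor_remainder {x : ℝ → ℝ} (hx : ContDiff ℝ 2 x) :
    Tendsto (fun t : ℝ => (x t - x 0 - deriv x 0 * t - iteratedDeriv 2 x 0 / 2 * t ^ 2) / t ^ 2)
      (𝓝[≠] 0) (𝓝 0) := by
  have h := (taylor_isLittleO_univ (x₀ := 0) (n := 2) hx).tendsto_div_nhds_zero
  refine (h.mono_left nhdsWithin_le_nhds).congr fun t => ?_
  simp only [taylorWithinEval_succ, taylor_within_zero_eval, iteratedDerivWithin_univ,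
    smul_eq_mul, sub_zero]
  norm_num
  ring

/-- **Twisted derivative of the affine ratio.** Let `x : ℝ → ℝ` be `C²` with `x'(0) ≠ 0`. Then
`lim_{ε→0} (1/ε)·((x(2ε) − x(0))/(x(ε) − x(0)) − 2) = x''(0)/x'(0)`,
the logarithmic derivative, a differential invariant of rank 1 and order 2. -/
theorem affine_ratio_twisted_derivative
    (x : ℝ → ℝ) (hx : ContDiff ℝ 2 x) (hx' : deriv x 0 ≠ 0) :
    Filter.Tendsto
      (fun ε : ℝ => ((x (2 * ε) - x 0) / (x ε - x 0) - 2) / ε)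
      (nhdsWithin 0 {0}ᶜ)
      (nhds (iteratedDeriv 2 x 0 / deriv x 0)) := by
  have hR := tendsto_quadratic_taylor_remainder hx
  set a := deriv x 0
  set b := iteratedDeriv 2 x 0
  have htwo : Filter.Tendsto (fun ε : ℝ => 2 * ε) (nhdsWithin 0 {0}ᶜ) (nhdsWithin 0 {0}ᶜ) := by
    refine tendsto_nhdsWithin_of_tendsto_nhds_of_eventually_within _ ?_ ?_
    · have h : Continuous fun ε : ℝ => 2 * ε := by fun_prop
      simpa using (h.tendsto 0).mono_left nhdsWithin_le_nhds
    · filter_upwards [self_mem_nhdsWithin] with ε hε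
      simpa using hε
  have hnum := (((hR.comp htwo).const_mul 4).sub (hR.const_mul 2)).const_add b
  have hden : Filter.Tendsto (fun ε : ℝ => (x ε - x 0) / ε) (nhdsWithin 0 {0}ᶜ) (nhds a) := by
    have h := (hx.differentiable (by norm_num) 0).hasDerivAt.tendsto_slope
    refine h.congr fun ε => ?_
    rw [slope_def_field, sub_zero]
  have hmain := hnum.div hden hx'
  simp only [mul_zero, sub_zero, add_zero] at hmain
  refine hmain.congr' ?_
  filter_upwards [self_mem_nhdsWithin, hden.eventually_ne hx'] with ε hε hne
  have hε' : ε ≠ 0 := hε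
  have hd : x ε - x 0 ≠ 0 := fun h => hne (by rw [h, zero_div])
  simp only [Pi.div_apply, Function.comp_apply]
  field_simp
  ring
end

section
/- Let x : ℝ → ℝ be a C³ function with x'(0) ≠ 0, and for small ε ≠ 0 define the anharmonic (cross) ratio CR_x(ε) = ((x(0) − x(2ε))·(x(ε) − x(3ε))) / ((x(0) − x(ε))·(x(2ε) − x(3ε))). Then CR_x(ε) → 4 as ε → 0 and lim_{ε→0} (CR_x(ε) − 4)/ε² = (3·x''(0)² − 2·x'(0)·x'''(0)) / x'(0)². (This is the paper's computation that the twisted second derivative of the anharmonic-ratio 4-joint invariant of PGL(2,ℝ) is the Schwarzian derivative, a differential invariant of rank 1 and order 3; for sufficiently small ε ≠ 0 all factors in the denominator are nonzero because x'(0) ≠ 0.) -/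
/-- The anharmonic (cross) ratio of the four points `u(0), u(ε), u(2ε), u(3ε)` on a curve `u`:
`CR_u(ε) = ((u(0) − u(2ε))·(u(ε) − u(3ε))) / ((u(0) − u(ε))·(u(2ε) − u(3ε)))`. -/
noncomputable def curveCrossRatio (u : ℝ → ℝ) (ε : ℝ) : ℝ :=
  ((u 0 - u (2 * ε)) * (u ε - u (3 * ε))) / ((u 0 - u ε) * (u (2 * ε) - u (3 * ε)))

open Filter Topology

/-- The quadratic Taylor remainder at `0`, divided by the cube of the variable. -/
noncomputable def cubicTaylorQuotient (f : ℝ → ℝ) (ε : ℝ) : ℝ :=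
  (f ε - f 0 - deriv f 0 * ε - iteratedDeriv 2 f 0 / 2 * ε ^ 2) / ε ^ 3

theorem tendsto_cubicTaylorQuotient {f : ℝ → ℝ} (hf : ContDiff ℝ 3 f) :
    Tendsto (cubicTaylorQuotient f) (𝓝[≠] 0) (𝓝 (iteratedDeriv 3 f 0 / 6)) := by
  have h := (taylor_isLittleO_univ (x₀ := 0) (n := 3) hf).tendsto_div_nhds_zero
  have h' := (h.mono_left (nhdsWithin_le_nhds (s := {0}ᶜ))).add_const (iteratedDeriv 3 f 0 / 6)
  rw [zero_add] at h'
  refine h'.congr' ?_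
  filter_upwards [self_mem_nhdsWithin] with ε hε
  have hε : ε ≠ 0 := hε
  simp only [cubicTaylorQuotient, taylor_within_apply, iteratedDerivWithin_univ,
    Finset.sum_range_succ, Finset.sum_range_zero, iteratedDeriv_zero, iteratedDeriv_one,
    Nat.factorial, smul_eq_mul, sub_zero]
  field_simp
  push_cast
  ring

theorem eq_add_cubicTaylorQuotient (f : ℝ → ℝ) {ε : ℝ} (hε : ε ≠ 0) :
    f ε = f 0 + deriv f 0 * ε + iteratedDeriv 2 f 0 / 2 * ε ^ 2
      + cubicTaylorQuotient f ε * ε ^ 3 := by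
  rw [cubicTaylorQuotient, div_mul_cancel₀ _ (pow_ne_zero 3 hε)]
  ring

theorem tendsto_const_mul_nhdsNE_zero {k : ℝ} (hk : k ≠ 0) :
    Tendsto (fun ε : ℝ => k * ε) (𝓝[≠] 0) (𝓝[≠] 0) := by
  refine tendsto_nhdsWithin_iff.2 ⟨?_, ?_⟩
  · exact (Continuous.tendsto' (by fun_prop) _ _ (mul_zero k)).mono_left nhdsWithin_le_nhds
  · filter_upwards [self_mem_nhdsWithin] with ε hε using mul_ne_zero hk hε

theorem tendsto_curveCrossRatio_sub_four_div_sq {x : ℝ → ℝ} (hx : ContDiff ℝ 3 x)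
    (hx' : deriv x 0 ≠ 0) :
    Tendsto (fun ε : ℝ => (curveCrossRatio x ε - 4) / ε ^ 2) (𝓝[≠] 0)
      (𝓝 ((3 * iteratedDeriv 2 x 0 ^ 2 - 2 * deriv x 0 * iteratedDeriv 3 x 0)
        / deriv x 0 ^ 2)) := by
  set a := deriv x 0 with ha
  set b := iteratedDeriv 2 x 0 / 2 with hb
  set c := iteratedDeriv 3 x 0 / 6 with hc
  have h1 := tendsto_cubicTaylorQuotient hx
  have h2 := h1.comp (tendsto_const_mul_nhdsNE_zero (two_ne_zero))
  have h3 := h1.comp (tendsto_const_mul_nhdsNE_zero (three_ne_zero))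
  set q := cubicTaylorQuotient x with hq
  have hlim : Tendsto (fun ε : ℝ => (ε, q ε, q (2 * ε), q (3 * ε))) (𝓝[≠] 0)
      (𝓝 (0, c, c, c)) :=
    (tendsto_id.mono_left nhdsWithin_le_nhds).prodMk_nhds
      (h1.prodMk_nhds (h2.prodMk_nhds h3))
  let Q₁ : ℝ × ℝ × ℝ × ℝ → ℝ := fun p => a + b * p.1 + p.2.1 * p.1 ^ 2
  let Q₂ : ℝ × ℝ × ℝ × ℝ → ℝ := fun p =>
    a + 5 * b * p.1 + (27 * p.2.2.2 - 8 * p.2.2.1) * p.1 ^ 2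
  let N : ℝ × ℝ × ℝ × ℝ → ℝ := fun p =>
    4 * (3 * b ^ 2 + a * (12 * p.2.2.1 - 3 / 2 * p.2.1 - 27 / 2 * p.2.2.2)
      + b * (24 * p.2.2.1 - 6 * p.2.1) * p.1
      + (2 * p.2.2.1 * (27 * p.2.2.2 - p.2.1) - p.2.1 * (27 * p.2.2.2 - 8 * p.2.2.1)) * p.1 ^ 2)
  have hQ₁ : Tendsto (fun ε => Q₁ (ε, q ε, q (2 * ε), q (3 * ε))) (𝓝[≠] 0) (𝓝 a) :=
    ((show Continuous Q₁ by fun_prop).tendsto' (0, c, c, c) _ (by simp [Q₁])).comp hlim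
  have hQ₂ : Tendsto (fun ε => Q₂ (ε, q ε, q (2 * ε), q (3 * ε))) (𝓝[≠] 0) (𝓝 a) :=
    ((show Continuous Q₂ by fun_prop).tendsto' (0, c, c, c) _ (by simp [Q₂])).comp hlim
  have hN : Tendsto (fun ε => N (ε, q ε, q (2 * ε), q (3 * ε))) (𝓝[≠] 0)
      (𝓝 (12 * b ^ 2 - 12 * a * c)) :=
    ((show Continuous N by fun_prop).tendsto' (0, c, c, c) _ (by simp only [N]; ring)).comp hlim
  have hmain := hN.div (hQ₁.mul hQ₂) (mul_ne_zero hx' hx')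
  have hval : (12 * b ^ 2 - 12 * a * c) / (a * a)
      = (3 * iteratedDeriv 2 x 0 ^ 2 - 2 * a * iteratedDeriv 3 x 0) / a ^ 2 := by
    rw [hb, hc, ← sq]
    ring
  rw [hval] at hmain
  refine hmain.congr' ?_
  filter_upwards [self_mem_nhdsWithin, hQ₁.eventually_ne hx', hQ₂.eventually_ne hx']
    with ε hε hne₁ hne₂
  have hε : ε ≠ 0 := hε
  have e1 := eq_add_cubicTaylorQuotient x hε
  have e2 := eq_add_cubicTaylorQuotient x (mul_ne_zero two_ne_zero hε)
  have e3 := eq_add_cubicTaylorQuotient x (mul_ne_zero three_ne_zero hε)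
  rw [← ha, ← hb, ← hq] at e1 e2 e3
  have hd₁ : x 0 - x ε = -ε * Q₁ (ε, q ε, q (2 * ε), q (3 * ε)) := by
    rw [e1]; ring
  have hd₂ : x (2 * ε) - x (3 * ε) = -ε * Q₂ (ε, q ε, q (2 * ε), q (3 * ε)) := by
    rw [e2, e3]; ring
  have hnum : (x 0 - x (2 * ε)) * (x ε - x (3 * ε))
      = ε ^ 2 * (4 * (Q₁ (ε, q ε, q (2 * ε), q (3 * ε)) * Q₂ (ε, q ε, q (2 * ε), q (3 * ε)))
        + ε ^ 2 * N (ε, q ε, q (2 * ε), q (3 * ε))) := by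
    rw [e1, e2, e3]; ring
  rw [curveCrossRatio, hnum, hd₁, hd₂, Pi.div_apply]
  generalize Q₁ (ε, q ε, q (2 * ε), q (3 * ε)) = u at hne₁ ⊢
  generalize Q₂ (ε, q ε, q (2 * ε), q (3 * ε)) = v at hne₂ ⊢
  field_simp
  ring

/-- **Twisted derivative of the anharmonic ratio is the Schwarzian.** Let `x : ℝ → ℝ` be `C³`
with `x'(0) ≠ 0`. Then `CR_x(ε) → 4` as `ε → 0`, and
`lim_{ε→0} (CR_x(ε) − 4)/ε² = (3·x''(0)² − 2·x'(0)·x'''(0))/x'(0)²`,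
the Schwarzian derivative, a differential invariant of rank 1 and order 3. -/
theorem anharmonic_ratio_twisted_derivative
    (x : ℝ → ℝ) (hx : ContDiff ℝ 3 x) (hx' : deriv x 0 ≠ 0) :
    Filter.Tendsto (curveCrossRatio x) (nhdsWithin 0 {0}ᶜ) (nhds 4) ∧
    Filter.Tendsto
      (fun ε : ℝ => (curveCrossRatio x ε - 4) / ε ^ 2)
      (nhdsWithin 0 {0}ᶜ)
      (nhds ((3 * iteratedDeriv 2 x 0 ^ 2 - 2 * deriv x 0 * iteratedDeriv 3 x 0)
        / deriv x 0 ^ 2)) := by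
  have h := tendsto_curveCrossRatio_sub_four_div_sq hx hx'
  refine ⟨?_, h⟩
  have hsq : Tendsto (fun ε : ℝ => ε ^ 2) (𝓝[≠] 0) (𝓝 0) :=
    (Continuous.tendsto' (by fun_prop) _ _ (by simp)).mono_left nhdsWithin_le_nhds
  have h4 := (h.mul hsq).add_const 4
  rw [mul_zero, zero_add] at h4
  refine h4.congr' ?_
  filter_upwards [self_mem_nhdsWithin] with ε hε
  rw [div_mul_cancel₀ _ (pow_ne_zero 2 hε), sub_add_cancel]
end
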